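/- For every h ≥ 1, liminf_{n→∞} A(n, 2h+1)/B(n,h) ≥ 1/(h+1)!, where B(n,h) = 2ⁿ/∑_{i=0}^{h} C(n,i) is the Hamming (sphere-packing) bound. In particular, A(n, 2h+1) ≥ (2ⁿ/((h+1)·nʰ))·(1+o(1)). -/

import Mathlib

/-- `A(n, d)`: maximal size of a binary code of length `n` with minimum
Hamming distance at least `d`. -/
noncomputable def An (n d : ℕ) : ℕ :=
  sSup {m | ∃ C : Finset (Fin n → ZMod 2), C.card = m ∧
    ∀ x ∈ C, ∀ y ∈ C, x ≠ y → d ≤ hammingDist x y}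

/-- The sphere-packing (Hamming) bound `B(n,h) = 2^n / ∑_{i≤h} C(n,i)`. -/
noncomputable def B (n h : ℕ) : ℝ :=
  2 ^ n / ∑ i ∈ Finset.range (h + 1), (n.choose i : ℝ)

section
open MeasureTheory Filter Topology Complex

noncomputable def FK (K u : ℝ) : ℝ := K * Real.sinc (K * u / 2) ^ 2

lemma FK_nonneg {K : ℝ} (hK : 0 < K) (u : ℝ) : 0 ≤ FK K u := by unfold FK; positivity

lemma FK_cont (K : ℝ) : Continuous (FK K) := by
  unfold FK
  have := Real.continuous_sinc
  fun_prop

lemma FK_real_integral {K : ℝ} (hK : 0 < K) (v : ℝ) :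
    ∫ τ in (0:ℝ)..K, (1 - τ / K) * (2 * Real.cos (τ * v)) = FK K v := by
  unfold FK
  rcases eq_or_ne v 0 with rfl | hv
  · have : ∀ τ ∈ Set.uIcc 0 K, HasDerivAt (fun τ : ℝ => 2 * τ - τ ^ 2 / K)
      ((1 - τ / K) * (2 * Real.cos (τ * 0))) τ := by
      intro τ _
      have h1 := ((hasDerivAt_id τ).const_mul 2).sub (((hasDerivAt_id τ).pow 2).div_const K)
      convert! h1 using 1
      simp; ring
    rw [intervalIntegral.integral_eq_sub_of_hasDerivAt this]
    · simp; field_simp; ring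
    · exact Continuous.intervalIntegrable (by fun_prop) _ _
  · have : ∀ τ ∈ Set.uIcc 0 K, HasDerivAt
      (fun τ : ℝ => (1 - τ / K) * (2 * Real.sin (τ * v) / v) - 2 * Real.cos (τ * v) / (K * v ^ 2))
      ((1 - τ / K) * (2 * Real.cos (τ * v))) τ := by
      intro τ _
      have h0 : HasDerivAt (fun τ : ℝ => τ * v) v τ := by
        simpa using (hasDerivAt_id τ).mul_const v
      have h1 : HasDerivAt (fun τ : ℝ => 1 - τ / K) (-(1 / K)) τ := by
        simpa using ((hasDerivAt_id τ).div_const K).const_sub 1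
      have h2 := (h1.mul ((h0.sin.const_mul 2).div_const v)).sub
        ((h0.cos.const_mul 2).div_const (K * v ^ 2))
      convert! h2 using 1
      field_simp
      ring
    rw [intervalIntegral.integral_eq_sub_of_hasDerivAt this]
    · have h3 : K * v / 2 ≠ 0 := by positivity
      rw [Real.sinc_of_ne_zero h3]
      have h4 : Real.cos (K * v) = 1 - 2 * Real.sin (K * v / 2) ^ 2 := by
        have := Real.cos_two_mul (K * v / 2)
        rw [show 2 * (K * v / 2) = K * v by ring] at this
        rw [this, Real.cos_sq']; ring
      rw [h4]
      simp
      field_simp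
      ring
    · exact Continuous.intervalIntegrable (by fun_prop) _ _

lemma FK_integral {K : ℝ} (hK : 0 < K) (v : ℝ) :
    ∫ τ in (-K)..K, ((1 - |τ| / K : ℝ) : ℂ) * cexp (I * τ * v) = (FK K v : ℂ) := by
  have hi : ∀ a b : ℝ, IntervalIntegrable (fun τ : ℝ => ((1 - |τ| / K : ℝ) : ℂ) * cexp (I * τ * v))
      volume a b := fun a b => Continuous.intervalIntegrable (by fun_prop) _ _
  rw [← intervalIntegral.integral_add_adjacent_intervals (hi (-K) 0) (hi 0 K)]
  have h1 : ∫ τ in (-K)..0, ((1 - |τ| / K : ℝ) : ℂ) * cexp (I * τ * v) =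
      ∫ τ in (0:ℝ)..K, ((1 - |τ| / K : ℝ) : ℂ) * cexp (I * (-τ : ℝ) * v) := by
    have := intervalIntegral.integral_comp_neg (a := 0) (b := K)
      (fun τ : ℝ => ((1 - |τ| / K : ℝ) : ℂ) * cexp (I * τ * v))
    simp only [abs_neg, neg_zero] at this
    exact this.symm
  rw [h1, ← intervalIntegral.integral_add]
  · rw [← FK_real_integral hK v, ← intervalIntegral.integral_ofReal]
    apply intervalIntegral.integral_congr
    intro τ hτ
    rw [Set.uIcc_of_le hK.le] at hτ
    simp only [abs_of_nonneg hτ.1]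
    push_cast
    rw [Complex.two_cos]
    rw [← mul_add, add_comm]
    congr 3 <;> ring_nf
  · exact Continuous.intervalIntegrable (by fun_prop) _ _
  · exact hi _ _

lemma FK_le {K : ℝ} (hK : 0 < K) {u : ℝ} (hu : u ≠ 0) : FK K u ≤ 4 / (K * u ^ 2) := by
  unfold FK
  rw [Real.sinc_of_ne_zero (by positivity)]
  have := Real.sin_sq_le_one (K * u / 2)
  rw [div_pow, show 4 / (K * u ^ 2) = K * (1 / (K * u / 2) ^ 2) by field_simp; ring]
  gcongr

lemma FK_le' {K : ℝ} (hK : 0 < K) (u : ℝ) : FK K u ≤ K := by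
  unfold FK
  have := Real.abs_sinc_le_one (K * u / 2)
  have : Real.sinc (K * u / 2) ^ 2 ≤ 1 := by rw [sq_le_one_iff_abs_le_one]; exact this
  nlinarith

lemma FK_integrable {K : ℝ} (hK : 0 < K) : Integrable (FK K) := by
  have h1 : Integrable (fun u : ℝ => (K + 4 / K) * (1 + u ^ 2)⁻¹) :=
    integrable_inv_one_add_sq.const_mul _
  refine h1.mono' (FK_cont K).aestronglyMeasurable (ae_of_all _ fun u => ?_)
  rw [Real.norm_of_nonneg (FK_nonneg hK u)]
  rw [← div_eq_mul_inv, le_div_iff₀ (by positivity)]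
  have h2 : FK K u * u ^ 2 ≤ 4 / K := by
    rcases eq_or_ne u 0 with rfl | hu
    · simp; positivity
    · have := FK_le hK hu
      rw [le_div_iff₀ (by positivity)] at this
      rw [le_div_iff₀ hK]; linarith
  have := FK_le' hK u
  linarith

lemma FK_lower {K : ℝ} (hK : 0 < K) {u : ℝ} (h0 : 0 ≤ u) (h1 : K * u ≤ 1) : K / 4 ≤ FK K u := by
  unfold FK
  have : 1 / 2 ≤ Real.sinc (K * u / 2) := by
    rcases eq_or_lt_of_le h0 with rfl | hu
    · simp; norm_num
    · have h3 : 0 < K * u / 2 := by positivity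
      rw [Real.sinc_of_ne_zero h3.ne', le_div_iff₀ h3]
      have h4 := Real.mul_le_sin h3.le (by linarith [Real.pi_gt_three])
      have : 1 / 2 ≤ 2 / Real.pi := by
        rw [div_le_div_iff₀ (by norm_num) Real.pi_pos]; linarith [Real.pi_le_four]
      nlinarith
  have h5 : 1 / 4 ≤ Real.sinc (K * u / 2) ^ 2 := by nlinarith
  nlinarith

lemma sinc_sq_ge {x D : ℝ} (hD : 0 < D) (hx : x ^ 2 ≤ D) :
    Real.sin x ^ 2 / D ≤ Real.sinc x ^ 2 := by
  rcases eq_or_ne x 0 with rfl | h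
  · simp
  · rw [Real.sinc_of_ne_zero h, div_pow]; gcongr

lemma FK_compare {δ : ℝ} (hδ : 0 < δ) : ∃ C : ℝ, 0 < C ∧ ∀ K : ℝ, 0 < K → ∀ u : ℝ, δ ≤ |u| →
    FK K u ≤ C / K * (FK 1 u + FK 1 (u - 1)) := by
  set c : ℝ := Real.sin (1/2) ^ 2 / 2 with hc
  have hs : 0 < Real.sin (1/2) := Real.sin_pos_of_pos_of_lt_pi (by norm_num) (by linarith [Real.pi_gt_three])
  have hcpos : 0 < c := by positivity
  refine ⟨(1 + 1 / δ) ^ 2 / c, by positivity, fun K hK u hu => ?_⟩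
  have hu0 : u ≠ 0 := by rintro rfl; simp at hu; linarith
  have hupos : 0 < |u| := by positivity
  refine (FK_le hK hu0).trans ?_
  set D : ℝ := (1 + 1 / δ) ^ 2 * u ^ 2 / 4 with hD
  have hDpos : 0 < D := by positivity
  have hb : 1 ≤ |u| / δ := by rw [le_div_iff₀ hδ]; linarith
  have e1 : (1 + 1 / δ) * |u| = |u| + |u| / δ := by ring
  have d1 : (1 * u / 2) ^ 2 ≤ D := by
    have : |u| ^ 2 ≤ ((1 + 1 / δ) * |u|) ^ 2 := by gcongr; rw [e1]; linarith
    rw [mul_pow, sq_abs] at this; rw [hD]; linarith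
  have d2 : (1 * (u - 1) / 2) ^ 2 ≤ D := by
    have h1 : |u - 1| ≤ (1 + 1 / δ) * |u| := by
      rw [e1]; have := abs_sub u 1; simp at this; linarith
    have : |u - 1| ^ 2 ≤ ((1 + 1 / δ) * |u|) ^ 2 := by gcongr
    rw [mul_pow, sq_abs, sq_abs] at this; rw [hD]; linarith
  have s1 := sinc_sq_ge hDpos d1
  have s2 := sinc_sq_ge hDpos d2
  have s3 : c ≤ Real.sin (1 * u / 2) ^ 2 + Real.sin (1 * (u - 1) / 2) ^ 2 := by
    set a := 1 * u / 2
    set b := 1 * (u - 1) / 2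
    have : Real.sin (1/2) = Real.sin a * Real.cos b - Real.cos a * Real.sin b := by
      rw [← Real.sin_sub]; congr 1; simp only [a, b]; ring
    rw [hc, this]
    have ha := Real.sin_sq_add_cos_sq a
    have hb := Real.sin_sq_add_cos_sq b
    have h1 : (Real.sin a * Real.cos b) ^ 2 ≤ Real.sin a ^ 2 := by
      rw [mul_pow]; nlinarith [sq_nonneg (Real.sin a), sq_nonneg (Real.sin b)]
    have h2 : (Real.cos a * Real.sin b) ^ 2 ≤ Real.sin b ^ 2 := by
      rw [mul_pow]; nlinarith [sq_nonneg (Real.sin a), sq_nonneg (Real.sin b)]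
    nlinarith [sq_nonneg (Real.sin a * Real.cos b + Real.cos a * Real.sin b)]
  have s4 : c / D ≤ FK 1 u + FK 1 (u - 1) := by
    unfold FK
    calc c / D ≤ (Real.sin (1 * u / 2) ^ 2 + Real.sin (1 * (u - 1) / 2) ^ 2) / D := by gcongr
      _ ≤ _ := by rw [add_div]; linarith
  calc 4 / (K * u ^ 2) = (1 + 1 / δ) ^ 2 / c / K * (c / D) := by
        rw [hD]; have : (1 + 1/δ) ≠ 0 := by positivity
        generalize 1 + 1 / δ = z at *
        field_simp
    _ ≤ _ := by gcongr
open ArithmeticFunction in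
noncomputable def Gz (s : ℂ) : ℂ := vonMangoldt.LFunctionResidueClassAux (1 : ZMod 1) s

lemma Gz_cont : ContinuousOn Gz {s | 1 ≤ s.re} :=
  ArithmeticFunction.vonMangoldt.continuousOn_LFunctionResidueClassAux (1 : ZMod 1)

lemma Gz_eq {s : ℂ} (hs : 1 < s.re) :
    Gz s = LSeries (fun n => (ArithmeticFunction.vonMangoldt n : ℂ)) s - 1 / (s - 1) := by
  have := ArithmeticFunction.vonMangoldt.eqOn_LFunctionResidueClassAux
    (a := (1 : ZMod 1)) isUnit_one hs
  unfold Gz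
  rw [this]
  have h : ∀ n : ℕ, (n : ZMod 1) = 1 := fun n => Subsingleton.elim _ _
  simp [ArithmeticFunction.vonMangoldt.residueClass, Set.indicator, h]

noncomputable def wt (σ : ℝ) (n : ℕ) : ℝ := ArithmeticFunction.vonMangoldt n / (n : ℝ) ^ σ

lemma wt_nonneg (σ : ℝ) (n : ℕ) : 0 ≤ wt σ n := by
  unfold wt
  have := ArithmeticFunction.vonMangoldt_nonneg (n := n)
  positivity

lemma wt_summable {σ : ℝ} (hσ : 1 < σ) : Summable (wt σ) := by
  have h := ArithmeticFunction.LSeriesSummable_vonMangoldt (s := (σ : ℂ)) (by simpa using hσ)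
  rw [LSeriesSummable, ← summable_norm_iff] at h
  refine h.congr fun n => ?_
  rw [LSeries.norm_term_eq]
  unfold wt
  split_ifs with h0
  · simp [h0]
  · simp [abs_of_nonneg ArithmeticFunction.vonMangoldt_nonneg]

lemma term_eq (σ τ : ℝ) (n : ℕ) :
    LSeries.term (fun n => (ArithmeticFunction.vonMangoldt n : ℂ)) (σ + I * τ) n
      = (wt σ n : ℂ) * cexp (-(I * τ * Real.log n)) := by
  rcases eq_or_ne n 0 with rfl | hn
  · simp [wt]
  · rw [LSeries.term_of_ne_zero hn]
    have hn' : (n : ℂ) ≠ 0 := by exact_mod_cast hn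
    rw [Complex.cpow_add _ _ hn', wt]
    push_cast
    rw [Complex.ofReal_cpow (by positivity)]
    have h2 : (n : ℂ) ^ (I * (τ : ℂ)) = cexp (I * τ * Real.log n) := by
      rw [Complex.cpow_def_of_ne_zero hn', ← Complex.natCast_log]; congr 1; ring
    rw [h2, Complex.exp_neg]
    push_cast
    rw [← Complex.natCast_log]
    field_simp

lemma pieceA {σ K : ℝ} (hσ : 1 < σ) (hK : 0 < K) (y : ℝ) :
    HasSum (fun n : ℕ => ((wt σ n * FK K (y - Real.log n) : ℝ) : ℂ))
      (∫ τ in (-K)..K, ((1 - |τ| / K : ℝ) : ℂ) * cexp (I * τ * y) *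
        LSeries (fun n => (ArithmeticFunction.vonMangoldt n : ℂ)) (σ + I * τ)) := by
  have key := intervalIntegral.hasSum_integral_of_dominated_convergence (μ := volume)
    (a := -K) (b := K)
    (F := fun (n : ℕ) (τ : ℝ) => ((1 - |τ| / K : ℝ) : ℂ) * cexp (I * τ * y) *
      ((wt σ n : ℂ) * cexp (-(I * τ * Real.log n))))
    (f := fun τ : ℝ => ((1 - |τ| / K : ℝ) : ℂ) * cexp (I * τ * y) *
        LSeries (fun n => (ArithmeticFunction.vonMangoldt n : ℂ)) (σ + I * τ))
    (fun n _ => wt σ n) ?_ ?_ ?_ ?_ ?_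
  · convert! key using 2 with n
    rw [ofReal_mul, ← FK_integral hK, ← intervalIntegral.integral_const_mul]
    congr 1; ext τ
    rw [show I * τ * ((y - Real.log n : ℝ) : ℂ) = I * τ * y + -(I * τ * Real.log n) by
      push_cast; ring, Complex.exp_add]
    ring
  · intro n
    apply Continuous.aestronglyMeasurable
    fun_prop
  · intro n
    refine ae_of_all _ fun τ hτ => ?_
    rw [Set.uIoc_of_le (by linarith)] at hτ
    have h1 : ‖cexp (I * τ * y)‖ = 1 := by
      rw [show I * (τ:ℂ) * y = ((τ * y : ℝ) : ℂ) * I by push_cast; ring, Complex.norm_exp_ofReal_mul_I]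
    have h2 : ‖cexp (-(I * τ * Real.log n))‖ = 1 := by
      rw [show -(I * (τ:ℂ) * Real.log n) = ((-(τ * Real.log n) : ℝ) : ℂ) * I by push_cast; ring,
        Complex.norm_exp_ofReal_mul_I]
    rw [norm_mul, norm_mul, norm_mul, h1, h2, norm_real, norm_real,
      Real.norm_of_nonneg (wt_nonneg _ _), mul_one, mul_one]
    have h3 : |τ| ≤ K := abs_le.2 ⟨hτ.1.le, hτ.2⟩
    have h4 : ‖1 - |τ| / K‖ ≤ 1 := by
      rw [Real.norm_eq_abs, abs_le]
      have : |τ| / K ≤ 1 := by rw [div_le_one hK]; exact h3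
      have : 0 ≤ |τ| / K := by positivity
      constructor <;> linarith
    nlinarith [wt_nonneg σ n]
  · exact ae_of_all _ fun τ _ => wt_summable hσ
  · exact intervalIntegrable_const
  · refine ae_of_all _ fun τ _ => ?_
    apply HasSum.mul_left
    have h := (ArithmeticFunction.LSeriesSummable_vonMangoldt (s := σ + I * τ)
      (by simpa using hσ)).hasSum
    convert! h using 2 with n
    exact (term_eq σ τ n).symm

lemma pieceB {σ K : ℝ} (hσ : 1 < σ) (hK : 0 < K) (y : ℝ) :
    ∫ τ in (-K)..K, ((1 - |τ| / K : ℝ) : ℂ) * cexp (I * τ * y) * (1 / (σ + I * τ - 1)) =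
    ((∫ t in Set.Ioi (0:ℝ), Real.exp (-(σ - 1) * t) * FK K (y - t) : ℝ) : ℂ) := by
  have h1 : ∀ τ : ℝ, (1 / (σ + I * τ - 1) : ℂ) = ∫ t in Set.Ioi (0:ℝ), cexp (-(σ + I * τ - 1) * t) := by
    intro τ
    rw [integral_exp_mul_complex_Ioi (by simp; linarith)]
    rw [ofReal_zero, mul_zero, Complex.exp_zero, neg_div_neg_eq]
  simp_rw [h1, ← integral_const_mul]
  rw [intervalIntegral_integral_swap]
  · rw [← integral_complex_ofReal]
    congr 1; ext t
    push_cast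
    rw [← FK_integral hK, ← intervalIntegral.integral_const_mul]
    congr 1; ext τ
    rw [mul_left_comm, mul_assoc, ← Complex.exp_add, ← Complex.exp_add]
    push_cast
    congr 2; ring
  · have h2 : Integrable (fun t : ℝ => Real.exp (-(σ - 1) * t)) (volume.restrict (Set.Ioi 0)) :=
      integrableOn_exp_mul_Ioi (by linarith) 0
    have h3 : Integrable (fun τ : ℝ => |1 - |τ| / K|) (volume.restrict (Set.uIoc (-K) K)) := by
      have : IntervalIntegrable (fun τ : ℝ => |1 - |τ| / K|) volume (-K) K :=
        Continuous.intervalIntegrable (by fun_prop) _ _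
      exact this.def'
    have h4 := h3.mul_prod h2
    refine h4.mono' ?_ (ae_of_all _ ?_)
    · apply Continuous.aestronglyMeasurable
      simp only [Function.uncurry_def]
      fun_prop
    · rintro ⟨τ, t⟩
      simp only [Function.uncurry]
      rw [norm_mul, norm_mul, norm_real, Complex.norm_exp, Complex.norm_exp, Real.norm_eq_abs]
      simp

noncomputable def Rz (K σ y : ℝ) : ℂ :=
  ∫ τ in (-K)..K, ((1 - |τ| / K : ℝ) : ℂ) * cexp (I * τ * y) * Gz (σ + I * τ)

lemma Gz_line_cont {σ : ℝ} (hσ : 1 ≤ σ) : Continuous (fun τ : ℝ => Gz (σ + I * τ)) := by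
  refine Gz_cont.comp_continuous (by fun_prop) fun τ => ?_
  simpa using hσ

lemma main_identity {σ K : ℝ} (hσ : 1 < σ) (hK : 0 < K) (y : ℝ) :
    HasSum (fun n : ℕ => wt σ n * FK K (y - Real.log n))
      ((∫ t in Set.Ioi (0:ℝ), Real.exp (-(σ - 1) * t) * FK K (y - t)) + (Rz K σ y).re) := by
  have hA := pieceA hσ hK y
  have hB := pieceB hσ hK y
  have h : Rz K σ y = (∫ τ in (-K)..K, ((1 - |τ| / K : ℝ) : ℂ) * cexp (I * τ * y) *
        LSeries (fun n => (ArithmeticFunction.vonMangoldt n : ℂ)) (σ + I * τ)) -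
      ((∫ t in Set.Ioi (0:ℝ), Real.exp (-(σ - 1) * t) * FK K (y - t) : ℝ) : ℂ) := by
    rw [← hB]
    have hne : ∀ τ : ℝ, (σ + I * τ - 1 : ℂ) ≠ 0 := by
      intro τ h
      have := congrArg Complex.re h
      simp at this; linarith
    have hc : Continuous (fun τ : ℝ => (1 / (σ + I * τ - 1) : ℂ)) :=
      Continuous.div (by fun_prop) (by fun_prop) hne
    have hL : ∀ τ : ℝ, LSeries (fun n => (ArithmeticFunction.vonMangoldt n : ℂ)) (σ + I * τ) =
        Gz (σ + I * τ) + 1 / (σ + I * τ - 1) := by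
      intro τ
      rw [Gz_eq (by simpa using hσ)]; ring
    have hg := Gz_line_cont hσ.le
    simp_rw [hL]
    rw [← intervalIntegral.integral_sub]
    · unfold Rz
      congr 1; ext τ; ring
    · exact Continuous.intervalIntegrable (by fun_prop) _ _
    · exact Continuous.intervalIntegrable (by fun_prop) _ _
  have h5 := Complex.hasSum_re hA
  simp only [ofReal_re] at h5
  convert! h5 using 1
  rw [h, sub_re, ofReal_re]; ring
lemma norm_kernel_le {K : ℝ} (hK : 0 < K) (y : ℝ) {τ : ℝ} (hτ : τ ∈ Set.uIoc (-K) K) :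
    ‖((1 - |τ| / K : ℝ) : ℂ) * cexp (I * τ * y)‖ ≤ 1 := by
  rw [Set.uIoc_of_le (by linarith)] at hτ
  have h1 : ‖cexp (I * τ * y)‖ = 1 := by
    rw [show I * (τ:ℂ) * y = ((τ * y : ℝ) : ℂ) * I by push_cast; ring, Complex.norm_exp_ofReal_mul_I]
  rw [norm_mul, h1, norm_real, mul_one]
  have h3 : |τ| ≤ K := abs_le.2 ⟨hτ.1.le, hτ.2⟩
  rw [Real.norm_eq_abs, abs_le]
  have : |τ| / K ≤ 1 := by rw [div_le_one hK]; exact h3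
  have : 0 ≤ |τ| / K := by positivity
  constructor <;> linarith

lemma Gz_strip_cont (K : ℝ) : ContinuousOn (fun p : ℝ × ℝ => Gz (p.1 + I * p.2))
    (Set.Icc 1 2 ×ˢ Set.Icc (-K) K) := by
  refine Gz_cont.comp (by fun_prop) ?_
  rintro ⟨σ, τ⟩ ⟨h1, _⟩
  simpa using h1.1

lemma strip_compact (K : ℝ) : IsCompact (Set.Icc (1:ℝ) 2 ×ˢ Set.Icc (-K) K) :=
  isCompact_Icc.prod isCompact_Icc

lemma Rz_bdd {K : ℝ} (hK : 0 < K) : ∃ M : ℝ, ∀ σ ∈ Set.Icc (1:ℝ) 2, ∀ y, ‖Rz K σ y‖ ≤ M := by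
  obtain ⟨C, hC⟩ := (strip_compact K).exists_bound_of_continuousOn (Gz_strip_cont K)
  refine ⟨C * |K - (-K)|, fun σ hσ y => ?_⟩
  refine intervalIntegral.norm_integral_le_of_norm_le_const fun τ hτ => ?_
  rw [norm_mul]
  have h1 := norm_kernel_le hK y hτ
  rw [Set.uIoc_of_le (by linarith)] at hτ
  have h2 := hC (σ, τ) ⟨hσ, hτ.1.le, hτ.2⟩
  simp only at h2
  nlinarith [norm_nonneg (Gz (σ + I * τ)), norm_nonneg (((1 - |τ| / K : ℝ) : ℂ) * cexp (I * τ * y))]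

lemma Rz_close {K : ℝ} (hK : 0 < K) {η : ℝ} (hη : 0 < η) : ∃ σ₁ : ℝ, 1 < σ₁ ∧ σ₁ ≤ 2 ∧
    ∀ σ, 1 < σ → σ < σ₁ → ∀ y, ‖Rz K σ y - Rz K 1 y‖ ≤ η := by
  have hu := (strip_compact K).uniformContinuousOn_of_continuous (Gz_strip_cont K)
  rw [Metric.uniformContinuousOn_iff] at hu
  obtain ⟨δ, hδ, hd⟩ := hu (η / (2 * K)) (by positivity)
  refine ⟨1 + min δ 1, by simp [hδ], by linarith [min_le_right δ 1], fun σ h1 h2 y => ?_⟩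
  have hσδ : σ - 1 < δ := by linarith [min_le_left δ 1]
  have hσ2 : σ ≤ 2 := by linarith [min_le_right δ 1]
  have hg := Gz_line_cont h1.le
  have hg1 := Gz_line_cont (le_refl 1)
  unfold Rz
  rw [← intervalIntegral.integral_sub]
  · have : η = (η / (2 * K)) * |K - (-K)| := by
      rw [abs_of_pos (by linarith)]; field_simp; ring
    rw [this]
    refine intervalIntegral.norm_integral_le_of_norm_le_const fun τ hτ => ?_
    have h1' := norm_kernel_le hK y hτ
    rw [Set.uIoc_of_le (by linarith)] at hτ
    rw [← mul_sub, norm_mul]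
    have h3 := hd (σ, τ) ⟨⟨h1.le, hσ2⟩, hτ.1.le, hτ.2⟩ (1, τ) ⟨⟨le_refl _, by norm_num⟩, hτ.1.le, hτ.2⟩
      (by
        rw [Prod.dist_eq]; simp only [dist_self]
        rw [Real.dist_eq, abs_of_pos (by linarith)]
        exact max_lt hσδ hδ)
    rw [dist_eq_norm] at h3
    simp only at h3
    refine (mul_le_of_le_one_left (norm_nonneg _) h1').trans h3.le
  · exact Continuous.intervalIntegrable (by fun_prop) _ _
  · exact Continuous.intervalIntegrable (by fun_prop) _ _

lemma Rz_tendsto {K : ℝ} (hK : 0 < K) : Tendsto (fun y => Rz K 1 y) atTop (𝓝 0) := by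
  have h := Real.tendsto_integral_exp_smul_cocompact
    ((Set.Ioc (-K) K).indicator fun τ : ℝ => ((1 - |τ| / K : ℝ) : ℂ) * Gz (1 + I * τ))
  have h2 : Tendsto (fun y : ℝ => -(y / (2 * Real.pi))) atTop (cocompact ℝ) := by
    have : Tendsto (fun y : ℝ => -(y / (2 * Real.pi))) atTop atBot :=
      tendsto_neg_atTop_atBot.comp (tendsto_id.atTop_div_const (by positivity))
    exact this.mono_right atBot_le_cocompact
  refine (h.comp h2).congr fun y => ?_
  simp only [Function.comp]
  unfold Rz
  rw [intervalIntegral.integral_of_le (by linarith), ← integral_indicator measurableSet_Ioc]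
  congr 1; ext τ
  simp only [Set.indicator]
  split_ifs
  · rw [Circle.smul_def, Real.fourierChar_apply, smul_eq_mul]
    have : (2 * Real.pi * -(τ * -(y / (2 * Real.pi)))) = τ * y := by field_simp
    rw [this]
    push_cast
    rw [show (τ : ℂ) * y * I = I * τ * y by ring]
    ring
  · simp

lemma J_integrable {σ K : ℝ} (hσ : 1 < σ) (hK : 0 < K) (y : ℝ) :
    IntegrableOn (fun t : ℝ => Real.exp (-(σ - 1) * t) * FK K (y - t)) (Set.Ioi 0) := by
  have h1 : Integrable (fun t => FK K (y - t)) := (FK_integrable hK).comp_sub_left y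
  refine h1.integrableOn.mono' ?_ ?_
  · have := FK_cont K
    exact Continuous.aestronglyMeasurable (by fun_prop)
  · filter_upwards [ae_restrict_mem measurableSet_Ioi] with t ht
    have ht : 0 < t := ht
    rw [Real.norm_of_nonneg (mul_nonneg (Real.exp_pos _).le (FK_nonneg hK _))]
    refine mul_le_of_le_one_left (FK_nonneg hK _) (Real.exp_le_one_iff.2 ?_)
    nlinarith

lemma J_le {σ K : ℝ} (hσ : 1 < σ) (hK : 0 < K) (y : ℝ) :
    ∫ t in Set.Ioi (0:ℝ), Real.exp (-(σ - 1) * t) * FK K (y - t) ≤ ∫ u, FK K u := by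
  have h1 : Integrable (fun t => FK K (y - t)) := (FK_integrable hK).comp_sub_left y
  calc _ ≤ ∫ t in Set.Ioi (0:ℝ), FK K (y - t) := by
        refine setIntegral_mono_on (J_integrable hσ hK y) h1.integrableOn measurableSet_Ioi ?_
        intro t ht
        have ht : 0 < t := ht
        refine mul_le_of_le_one_left (FK_nonneg hK _) (Real.exp_le_one_iff.2 ?_)
        nlinarith
    _ ≤ ∫ t, FK K (y - t) := setIntegral_le_integral h1 (ae_of_all _ fun t => FK_nonneg hK _)
    _ = _ := integral_sub_left_eq_self (FK K) volume y

lemma J_ge {σ K : ℝ} (hσ : 1 < σ) (hK : 0 < K) {y : ℝ} (hy : 1 / K ≤ y) :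
    Real.exp (-(σ - 1) * y) / 4 ≤
      ∫ t in Set.Ioi (0:ℝ), Real.exp (-(σ - 1) * t) * FK K (y - t) := by
  have hi := J_integrable hσ hK y
  have hsub : Set.Ioc (y - 1 / K) y ⊆ Set.Ioi 0 := by
    intro t ht
    have := ht.1
    simp only [Set.mem_Ioi]; linarith
  calc Real.exp (-(σ - 1) * y) / 4 = ∫ t in Set.Ioc (y - 1 / K) y, Real.exp (-(σ - 1) * y) * (K / 4) := by
        rw [setIntegral_const]
        simp [hK.le]
        field_simp
    _ ≤ ∫ t in Set.Ioc (y - 1 / K) y, Real.exp (-(σ - 1) * t) * FK K (y - t) := by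
        refine setIntegral_mono_on (integrableOn_const (by simp)) (hi.mono_set hsub) measurableSet_Ioc ?_
        intro t ht
        have h2 : K / 4 ≤ FK K (y - t) := by
          refine FK_lower hK (by linarith [ht.2]) ?_
          have : y - t ≤ 1 / K := by linarith [ht.1]
          rw [le_div_iff₀ hK] at this; linarith
        have h3 : -(σ - 1) * y ≤ -(σ - 1) * t := by nlinarith [ht.2]
        gcongr
    _ ≤ _ := by
        refine setIntegral_mono_set hi ?_ hsub.eventuallyLE
        exact ae_of_all _ fun t => mul_nonneg (Real.exp_pos _).le (FK_nonneg hK _)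

lemma log_gap {δ : ℝ} (hδ : 0 < δ) :
    ∀ᶠ y : ℝ in atTop, ∃ q : ℕ, IsPrimePow q ∧ |y - Real.log q| < δ := by
  obtain ⟨C, hC, hcomp⟩ := FK_compare hδ
  obtain ⟨M, hM⟩ := Rz_bdd one_pos
  set M' : ℝ := (∫ u, FK 1 u) + M with hM'
  have hW : ∀ σ, 1 < σ → σ ≤ 2 → ∀ y, ∑' n : ℕ, wt σ n * FK 1 (y - Real.log n) ≤ M' := by
    intro σ h1 h2 y
    rw [(main_identity h1 one_pos y).tsum_eq]
    have a := J_le h1 one_pos y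
    have b := hM σ ⟨h1.le, h2⟩ y
    have c := (Complex.abs_re_le_norm (Rz 1 σ y))
    linarith [le_abs_self (Rz 1 σ y).re]
  have hM0 : 0 ≤ M' := (tsum_nonneg fun n => mul_nonneg (wt_nonneg 2 n) (FK_nonneg one_pos _)).trans
    (hW 2 (by norm_num) le_rfl 0)
  set K : ℝ := 64 * (C * M' + 1) with hKdef
  have hK : 0 < K := by positivity
  have hKM : C / K * (M' + M') ≤ 1 / 32 := by
    rw [div_mul_eq_mul_div, div_le_iff₀ hK, hKdef]; nlinarith [mul_nonneg hC.le hM0]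
  obtain ⟨σ₁, hσ1, hσ2, hclose⟩ := Rz_close hK (η := 1 / 64) (by norm_num)
  have hR := (Metric.tendsto_nhds.1 (Rz_tendsto hK)) (1 / 64) (by norm_num)
  filter_upwards [hR, eventually_ge_atTop (1 / K), eventually_gt_atTop 0] with y hy1 hy2 hy3
  by_contra! hno
  obtain ⟨σ, h1, h2, h3⟩ : ∃ σ, 1 < σ ∧ σ < σ₁ ∧ (1 / 2 : ℝ) ≤ Real.exp (-(σ - 1) * y) := by
    have hc : Tendsto (fun σ : ℝ => Real.exp (-(σ - 1) * y)) (𝓝[>] 1) (𝓝 (Real.exp (-(1 - 1) * y))) :=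
      ((by fun_prop : Continuous (fun σ : ℝ => Real.exp (-(σ - 1) * y))).tendsto 1).mono_left
        nhdsWithin_le_nhds
    have e1 : ∀ᶠ σ in 𝓝[>] (1:ℝ), 1 / 2 < Real.exp (-(σ - 1) * y) :=
      hc.eventually_const_lt (by simp; norm_num)
    have e2 : ∀ᶠ σ in 𝓝[>] (1:ℝ), σ ∈ Set.Ioo 1 σ₁ := Ioo_mem_nhdsGT hσ1
    obtain ⟨σ, a, b⟩ := (e1.and e2).exists
    exact ⟨σ, b.1, b.2, a.le⟩
  have hid := main_identity h1 hK y
  have hJ := J_ge h1 hK hy2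
  have i1 := main_identity h1 one_pos y
  have i2 := main_identity h1 one_pos (y - 1)
  have hup : ∑' n : ℕ, wt σ n * FK K (y - Real.log n) ≤ C / K * (M' + M') := by
    calc _ ≤ ∑' n : ℕ, C / K * (wt σ n * FK 1 (y - Real.log n) + wt σ n * FK 1 (y - 1 - Real.log n)) := by
          refine hid.summable.tsum_le_tsum (fun n => ?_) ((i1.summable.add i2.summable).mul_left _)
          by_cases hn : IsPrimePow n
          · have := hcomp K hK _ (hno n hn)
            rw [show y - 1 - Real.log n = y - Real.log n - 1 by ring]
            calc _ ≤ wt σ n * (C / K * (FK 1 (y - Real.log n) + FK 1 (y - Real.log n - 1))) :=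
                  mul_le_mul_of_nonneg_left this (wt_nonneg _ _)
              _ = _ := by ring
          · have : wt σ n = 0 := by
              unfold wt; rw [ArithmeticFunction.vonMangoldt_eq_zero_iff.2 hn, zero_div]
            simp [this]
      _ = C / K * (∑' n : ℕ, wt σ n * FK 1 (y - Real.log n) +
            ∑' n : ℕ, wt σ n * FK 1 (y - 1 - Real.log n)) := by
          rw [tsum_mul_left, i1.summable.tsum_add i2.summable]
      _ ≤ _ := by
          have a := hW σ h1 (by linarith) y
          have b := hW σ h1 (by linarith) (y - 1)
          gcongr
  rw [hid.tsum_eq] at hup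
  have c1 := hclose σ h1 h2 y
  rw [dist_zero_right] at hy1
  have c2 : ‖Rz K σ y‖ ≤ 1 / 32 := by
    calc ‖Rz K σ y‖ = ‖(Rz K σ y - Rz K 1 y) + Rz K 1 y‖ := by rw [sub_add_cancel]
      _ ≤ _ := norm_add_le _ _
      _ ≤ _ := by linarith
  have c3 := Complex.abs_re_le_norm (Rz K σ y)
  have c4 := neg_abs_le (Rz K σ y).re
  linarith

lemma primepow_gap {ε : ℝ} (hε : 0 < ε) :
    ∀ᶠ n : ℕ in atTop, ∃ q : ℕ, IsPrimePow q ∧ n + 1 ≤ q ∧ (q : ℝ) ≤ (1 + ε) * n := by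
  set δ : ℝ := Real.log (1 + ε) / 3 with hδ
  have hδpos : 0 < δ := div_pos (Real.log_pos (by linarith)) (by norm_num)
  have h1 : Tendsto (fun n : ℕ => Real.log n + 2 * δ) atTop atTop :=
    tendsto_atTop_add_const_right _ _ (Real.tendsto_log_atTop.comp tendsto_natCast_atTop_atTop)
  have h2 : ∀ᶠ n : ℕ in atTop, 1 / δ ≤ (n : ℝ) :=
    tendsto_natCast_atTop_atTop.eventually_ge_atTop _
  filter_upwards [h1.eventually (log_gap hδpos), h2, eventually_gt_atTop 0] with n hn hn2 hn0
  obtain ⟨q, hq, hlog⟩ := hn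
  refine ⟨q, hq, ?_, ?_⟩
  all_goals
    rw [abs_lt] at hlog
    have hq0 : (0:ℝ) < q := by exact_mod_cast hq.pos
    have hn0' : (0:ℝ) < n := by exact_mod_cast hn0
  · have : (n : ℝ) * Real.exp δ ≤ q := by
      calc (n : ℝ) * Real.exp δ = Real.exp (Real.log n + δ) := by
            rw [Real.exp_add, Real.exp_log hn0']
        _ ≤ Real.exp (Real.log q) := Real.exp_le_exp.2 (by linarith)
        _ = q := Real.exp_log hq0
    have h3 := Real.add_one_le_exp δ
    rw [div_le_iff₀ hδpos] at hn2
    have : (n : ℝ) + 1 ≤ q := by nlinarith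
    exact_mod_cast this
  · have e : (1 + ε) = Real.exp (3 * δ) := by
      rw [hδ, mul_div_cancel₀ _ (by norm_num), Real.exp_log (by linarith)]
    calc (q : ℝ) = Real.exp (Real.log q) := (Real.exp_log hq0).symm
      _ ≤ Real.exp (3 * δ + Real.log n) := Real.exp_le_exp.2 (by linarith)
      _ = (1 + ε) * n := by rw [Real.exp_add, Real.exp_log hn0', e]
end

section
open Filter Topology
lemma le_An {n d : ℕ} (C : Finset (Fin n → ZMod 2))
    (hC : ∀ x ∈ C, ∀ y ∈ C, x ≠ y → d ≤ hammingDist x y) : C.card ≤ An n d := by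
  refine le_csSup ⟨Fintype.card (Fin n → ZMod 2), ?_⟩ ⟨C, rfl, hC⟩
  rintro m ⟨D, rfl, _⟩
  exact Finset.card_le_univ D

lemma hamming_bound {n h : ℕ} (C : Finset (Fin n → ZMod 2))
    (hC : ∀ x ∈ C, ∀ y ∈ C, x ≠ y → 2 * h + 1 ≤ hammingDist x y) :
    C.card * ∑ i ∈ Finset.range (h + 1), n.choose i ≤ 2 ^ n := by
  classical
  set T : Finset (Finset (Fin n)) := Finset.univ.filter (fun S => S.card ≤ h) with hT
  have hTc : T.card = ∑ i ∈ Finset.range (h + 1), n.choose i := by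
    rw [Finset.card_eq_sum_card_fiberwise (f := Finset.card) (t := Finset.range (h + 1))]
    · refine Finset.sum_congr rfl fun i hi => ?_
      have hi' : i ≤ h := by simpa [Nat.lt_succ_iff] using hi
      have : (T.filter fun S => S.card = i) = Finset.powersetCard i Finset.univ := by
        ext S
        simp only [hT, Finset.mem_filter, Finset.mem_univ, true_and, Finset.mem_powersetCard,
          Finset.subset_univ]
        constructor
        · rintro ⟨_, h⟩; exact h
        · rintro h; exact ⟨by omega, h⟩
      rw [this, Finset.card_powersetCard]; simp
    · intro S hS
      simp [hT] at hS
      simp; omega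
  let ind : Finset (Fin n) → (Fin n → ZMod 2) := fun S i => if i ∈ S then 1 else 0
  have hd : ∀ x S, hammingDist x (x + ind S) ≤ S.card := by
    intro x S
    refine Finset.card_le_card fun i hi => ?_
    simp only [Finset.mem_filter, Finset.mem_univ, true_and, Pi.add_apply, ind] at hi
    by_contra h
    simp [h] at hi
  rw [← hTc, ← Finset.card_product]
  have : (2:ℕ) ^ n = (Finset.univ : Finset (Fin n → ZMod 2)).card := by
    simp [ZMod.card]
  rw [this]
  refine Finset.card_le_card_of_injOn (fun p => p.1 + ind p.2) (fun _ _ => Finset.mem_coe.2 (Finset.mem_univ _)) ?_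
  rintro ⟨x, S⟩ hx ⟨y, S'⟩ hy hxy
  simp only [Finset.coe_product, Set.mem_prod, Finset.mem_coe, hT, Finset.mem_filter,
    Finset.mem_univ, true_and] at hx hy hxy
  have hxy' : x = y := by
    by_contra hne
    have h1 := hC x hx.1 y hy.1 hne
    have h2 := hammingDist_triangle x (x + ind S) y
    have h3 := hd x S
    have h4 := hd y S'
    rw [hxy] at h2 h3
    rw [hammingDist_comm (y + ind S') y] at h2
    omega
  subst hxy'
  have h5 : ind S = ind S' := add_left_cancel hxy
  congr 1
  ext i
  have := congrFun h5 i
  simp only [ind] at this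
  by_cases a : i ∈ S <;> by_cases b : i ∈ S' <;> simp [a, b] at this ⊢

open Polynomial in
lemma sep {N h : ℕ} {F : Type*} [Field F] (a : Fin N → F) (ha : Function.Injective a)
    (S T : Finset (Fin N)) (hw : (S.card : ZMod (2 * h + 2)) = (T.card : ZMod (2 * h + 2)))
    (hc : ∀ j : Fin h, (∏ i ∈ S, (1 + C (a i) * X)).coeff (j + 1) =
      (∏ i ∈ T, (1 + C (a i) * X)).coeff (j + 1))
    (hd : (S \ T).card + (T \ S).card ≤ 2 * h + 1) : (S \ T) = ∅ ∧ (T \ S) = ∅ := by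
  classical
  set P : Finset (Fin N) → F[X] := fun S => ∏ i ∈ S, (1 + C (a i) * X) with hP
  have hS : P S = P (S ∩ T) * P (S \ T) := by
    have := Finset.prod_inter_mul_prod_sdiff S T (fun i => (1 + C (a i) * X : F[X]))
    exact this.symm
  have hTT : P T = P (S ∩ T) * P (T \ S) := by
    have := Finset.prod_inter_mul_prod_sdiff T S (fun i => (1 + C (a i) * X : F[X]))
    rw [Finset.inter_comm] at this
    exact this.symm
  have cS : S.card = (S ∩ T).card + (S \ T).card := (Finset.card_inter_add_card_sdiff S T).symm
  have cT : T.card = (S ∩ T).card + (T \ S).card := by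
    rw [Finset.inter_comm]; exact (Finset.card_inter_add_card_sdiff T S).symm
  have hcard : (S \ T).card = (T \ S).card := by
    rw [cS, cT] at hw
    push_cast at hw
    have hw' := add_left_cancel hw
    rw [ZMod.natCast_eq_natCast_iff, Nat.ModEq, Nat.mod_eq_of_lt (by omega),
      Nat.mod_eq_of_lt (by omega)] at hw'
    exact hw'
  have hle : (S \ T).card ≤ h := by omega
  have hcoeff0 : ∀ U, (P U).coeff 0 = 1 := by
    intro U
    rw [coeff_zero_eq_eval_zero, hP, eval_prod]
    simp
  have hdvd : (X : F[X]) ^ (h + 1) ∣ P S - P T := by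
    rw [X_pow_dvd_iff]
    intro d hd
    rw [coeff_sub, sub_eq_zero]
    rcases d with _ | d
    · rw [hcoeff0, hcoeff0]
    · exact hc ⟨d, by omega⟩
  have hcop : IsCoprime ((X : F[X]) ^ (h + 1)) (P (S ∩ T)) := by
    apply IsCoprime.pow_left
    apply IsCoprime.prod_right
    intro i _
    exact ⟨-C (a i), 1, by ring⟩
  have hdvd2 : (X : F[X]) ^ (h + 1) ∣ P (S \ T) - P (T \ S) := by
    apply hcop.dvd_of_dvd_mul_left
    rw [mul_sub, ← hS, ← hTT]; exact hdvd
  have hdeg : ∀ U : Finset (Fin N), (P U).natDegree ≤ U.card := by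
    intro U
    refine (natDegree_prod_le _ _).trans ?_
    rw [Finset.card_eq_sum_ones]
    refine Finset.sum_le_sum fun i _ => ?_
    compute_degree
  have hPeq : P (S \ T) = P (T \ S) := by
    rw [← sub_eq_zero]
    refine eq_zero_of_dvd_of_natDegree_lt hdvd2 ?_
    rw [natDegree_X_pow]
    have h1 := hdeg (S \ T)
    have h2 := hdeg (T \ S)
    have := natDegree_sub_le (P (S \ T)) (P (T \ S))
    have := max_le h1 (hcard ▸ h2)
    omega
  have key : ∀ U V : Finset (Fin N), Disjoint U V → P U = P V → ∀ i ∈ U, a i = 0 := by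
    intro U V hUV hPUV i hi
    by_contra hne
    have h1 : (P U).eval (-(a i)⁻¹) = 0 := by
      rw [hP, eval_prod]
      exact Finset.prod_eq_zero hi (by simp [hne])
    rw [hPUV, hP, eval_prod, Finset.prod_eq_zero_iff] at h1
    obtain ⟨j, hj, hj0⟩ := h1
    have : a j = a i := by
      simp at hj0
      field_simp at hj0
      exact (sub_eq_zero.1 (by linear_combination hj0)).symm
    have := ha this
    subst this
    exact Finset.disjoint_left.1 hUV hi hj
  have hdis : Disjoint (S \ T) (T \ S) := disjoint_sdiff_sdiff
  have hA : S \ T = ∅ := by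
    by_contra hne
    obtain ⟨i, hi⟩ := Finset.nonempty_iff_ne_empty.2 hne
    have : 0 < (T \ S).card := by rw [← hcard]; exact Finset.card_pos.2 ⟨i, hi⟩
    obtain ⟨j, hj⟩ := Finset.card_pos.1 this
    have e1 := key _ _ hdis hPeq i hi
    have e2 := key _ _ hdis.symm hPeq.symm j hj
    have := ha (e1.trans e2.symm)
    subst this
    exact Finset.disjoint_left.1 hdis hi hj
  refine ⟨hA, ?_⟩
  rw [hA] at hcard
  exact Finset.card_eq_zero.1 (by simpa using hcard.symm)

open Polynomial in
lemma code_exists_field {n h : ℕ} {F : Type} [Field F] [Fintype F] (hn : n + 1 ≤ Fintype.card F) :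
    2 ^ n ≤ (h + 1) * Fintype.card F ^ h * An n (2 * h + 1) := by
  classical
  obtain ⟨a⟩ : Nonempty (Fin (n + 1) ↪ F) := Function.Embedding.nonempty_of_card_le (by simpa using hn)
  let supp : (Fin (n + 1) → ZMod 2) → Finset (Fin (n + 1)) := fun x => Finset.univ.filter (fun i => x i = 1)
  let cl : (Fin (n + 1) → ZMod 2) → ZMod (2 * h + 2) × (Fin h → F) := fun x =>
    (((supp x).card : ZMod (2 * h + 2)), fun j => (∏ i ∈ supp x, (1 + C (a i) * X)).coeff (j + 1))
  have : NeZero (2 * h + 2) := ⟨by omega⟩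
  have hQ : Fintype.card (ZMod (2 * h + 2) × (Fin h → F)) = (2 * h + 2) * Fintype.card F ^ h := by
    simp [ZMod.card]
  obtain ⟨c, -, hc⟩ : ∃ c ∈ (Finset.univ : Finset (ZMod (2 * h + 2) × (Fin h → F))), 2 ^ (n + 1) ≤
      Fintype.card (ZMod (2 * h + 2) × (Fin h → F)) * (Finset.univ.filter (fun x => cl x = c)).card := by
    apply Finset.exists_le_of_sum_le Finset.univ_nonempty
    rw [← Finset.mul_sum, ← Finset.card_eq_sum_card_fiberwise (fun _ _ => Finset.mem_coe.2 (Finset.mem_univ _))]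
    simp [ZMod.card]
  set D := Finset.univ.filter (fun x => cl x = c) with hD
  have hdist : ∀ x ∈ D, ∀ y ∈ D, x ≠ y → 2 * h + 2 ≤ hammingDist x y := by
    intro x hx y hy hne
    by_contra! hlt
    have hcl : cl x = cl y := by
      simp [hD] at hx hy; rw [hx, hy]
    have z2 : ∀ u v : ZMod 2, u ≠ v → (u = 1 ∧ v ≠ 1) ∨ (v = 1 ∧ u ≠ 1) := by decide
    have z2' : ∀ u v : ZMod 2, (u = 1 → v = 1) → (v = 1 → u = 1) → u = v := by decide
    have hcard : (supp x \ supp y).card + (supp y \ supp x).card ≤ hammingDist x y := by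
      rw [← Finset.card_union_of_disjoint disjoint_sdiff_sdiff]
      refine Finset.card_le_card fun i hi => ?_
      simp [supp] at hi ⊢
      rintro h
      rw [h] at hi
      tauto
    simp only [cl, Prod.mk.injEq] at hcl
    have h1 := sep a a.injective (supp x) (supp y) hcl.1
      (fun j => congrFun hcl.2 j) (by omega)
    apply hne
    ext1 i
    apply z2'
    · intro hi
      have := (Finset.sdiff_eq_empty_iff_subset.1 h1.1) (show i ∈ supp _ by simpa [supp] using hi)
      simpa [supp] using this
    · intro hi
      have := (Finset.sdiff_eq_empty_iff_subset.1 h1.2) (show i ∈ supp _ by simpa [supp] using hi)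
      simpa [supp] using this
  have htail : ∀ x y : Fin (n + 1) → ZMod 2, hammingDist x y ≤ hammingDist (Fin.tail x) (Fin.tail y) + 1 := by
    intro x y
    have e : (Finset.univ.filter fun i : Fin n => x i.succ ≠ y i.succ).card =
        hammingDist (Fin.tail x) (Fin.tail y) := by
      unfold hammingDist
      congr 1
    rw [← e]
    have e2 : hammingDist x y = (Finset.univ.filter fun i : Fin (n + 1) => x i ≠ y i).card := by
      unfold hammingDist
      congr 1
    rw [e2, Fin.card_filter_univ_succ]
    split_ifs <;> omega
  have hinj : Set.InjOn (Fin.tail : (Fin (n + 1) → ZMod 2) → _) D := by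
    intro x hx y hy hxy
    by_contra hne
    have h1 := hdist x hx y hy hne
    have h2 := htail x y
    rw [hxy, hammingDist_self] at h2
    omega
  have hAn := le_An (d := 2 * h + 1) (D.image Fin.tail) (by
    intro x hx y hy hne
    obtain ⟨x', hx', rfl⟩ := Finset.mem_image.1 hx
    obtain ⟨y', hy', rfl⟩ := Finset.mem_image.1 hy
    have h1 := hdist x' hx' y' hy' (fun e => hne (by rw [e]))
    have h2 := htail x' y'
    omega)
  rw [Finset.card_image_of_injOn hinj] at hAn
  rw [hQ] at hc
  have h3 : (2 * h + 2) * Fintype.card F ^ h * D.card ≤ (2 * h + 2) * Fintype.card F ^ h * An n (2 * h + 1) := by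
    gcongr
  have h4 : 2 * 2 ^ n ≤ 2 * ((h + 1) * Fintype.card F ^ h * An n (2 * h + 1)) := by
    calc 2 * 2 ^ n = 2 ^ (n + 1) := by ring
      _ ≤ _ := hc.trans h3
      _ = _ := by ring
  omega

lemma code_exists {n h q : ℕ} (hq : IsPrimePow q) (hn : n + 1 ≤ q) :
    2 ^ n ≤ (h + 1) * q ^ h * An n (2 * h + 1) := by
  obtain ⟨p, k, hp, hk, rfl⟩ := hq
  have : Fact p.Prime := ⟨hp.nat_prime⟩
  have := Fintype.ofFinite (GaloisField p k)
  have hcard : Fintype.card (GaloisField p k) = p ^ k := by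
    rw [← Nat.card_eq_fintype_card]; exact GaloisField.card p k hk.ne'
  have := code_exists_field (n := n) (h := h) (F := GaloisField p k) (by rw [hcard]; exact hn)
  rwa [hcard] at this

lemma ratio_le_one (n h : ℕ) : (An n (2 * h + 1) : ℝ) / B n h ≤ 1 := by
  have hS : 0 < ∑ i ∈ Finset.range (h + 1), n.choose i :=
    Finset.sum_pos' (fun _ _ => Nat.zero_le _) ⟨0, by simp, by simp⟩
  have hA : An n (2 * h + 1) * ∑ i ∈ Finset.range (h + 1), n.choose i ≤ 2 ^ n := by
    rw [← Nat.le_div_iff_mul_le hS]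
    refine csSup_le ⟨0, ∅, by simp⟩ ?_
    rintro m ⟨C, rfl, hC⟩
    rw [Nat.le_div_iff_mul_le hS]
    exact hamming_bound C hC
  unfold B
  have hS' : (0:ℝ) < ∑ i ∈ Finset.range (h + 1), (n.choose i : ℝ) := by exact_mod_cast hS
  rw [div_le_one (by positivity), le_div_iff₀ hS']
  exact_mod_cast hA

lemma ratio_ge {n h q : ℕ} (hq : IsPrimePow q) (hn : n + 1 ≤ q) :
    1 / ((h + 1).factorial : ℝ) * (((n + 1 - h : ℕ) : ℝ) / q) ^ h ≤ (An n (2 * h + 1) : ℝ) / B n h := by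
  have h1 : (2:ℝ) ^ n ≤ (h + 1) * q ^ h * An n (2 * h + 1) := by exact_mod_cast code_exists hq hn
  have hq0 : (0:ℝ) < q := by exact_mod_cast hq.pos
  have h2 : ((n + 1 - h : ℕ) : ℝ) ^ h / (h.factorial : ℝ) ≤ ∑ i ∈ Finset.range (h + 1), (n.choose i : ℝ) :=
    (Nat.pow_le_choose h n).trans
      (Finset.single_le_sum (f := fun i => (n.choose i : ℝ)) (fun _ _ => by positivity) (by simp))
  set S := ∑ i ∈ Finset.range (h + 1), (n.choose i : ℝ) with hS
  have hfac : (0:ℝ) < h.factorial := by positivity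
  unfold B
  rw [← hS, div_div_eq_mul_div]
  calc _ = ((n + 1 - h : ℕ) : ℝ) ^ h / (h.factorial : ℝ) / ((h + 1) * q ^ h) := by
        rw [Nat.factorial_succ]; push_cast; rw [div_pow]; field_simp
    _ ≤ S / ((h + 1) * q ^ h) := by gcongr
    _ ≤ _ := by
        rw [div_le_div_iff₀ (by positivity) (by positivity)]
        have : 0 ≤ S := by rw [hS]; positivity
        calc S * 2 ^ n ≤ S * ((h + 1) * q ^ h * An n (2 * h + 1)) := by gcongr
          _ = _ := by ring

end

open Topology

open Filter in
theorem stmt19 (h : ℕ) (hh : 1 ≤ h) :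
    (1 : ℝ) / (h + 1).factorial ≤
      Filter.liminf (fun n : ℕ => (An n (2 * h + 1) : ℝ) / B n h) atTop := by
  have hcob : IsCoboundedUnder (· ≥ ·) atTop (fun n : ℕ => (An n (2 * h + 1) : ℝ) / B n h) :=
    (isBoundedUnder_of ⟨1, fun n => ratio_le_one n h⟩ :
      IsBoundedUnder (· ≤ ·) atTop _).isCoboundedUnder_ge
  refine le_of_forall_lt_imp_le_of_dense fun c hc => ?_
  refine le_liminf_of_le hcob ?_
  obtain ⟨ε, hε, hcε⟩ : ∃ ε : ℝ, 0 < ε ∧ c < 1 / ((h + 1).factorial : ℝ) * (1 / (1 + ε) ^ 2) ^ h := by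
    have hcont : ContinuousAt (fun ε : ℝ => 1 / ((h + 1).factorial : ℝ) * (1 / (1 + ε) ^ 2) ^ h) 0 := by
      have : ((1:ℝ) + 0) ^ 2 ≠ 0 := by norm_num
      fun_prop (disch := assumption)
    have e1 : ∀ᶠ ε in 𝓝 (0:ℝ), c < 1 / ((h + 1).factorial : ℝ) * (1 / (1 + ε) ^ 2) ^ h :=
      hcont.tendsto.eventually_const_lt (by simpa using hc)
    have e2 : ∀ᶠ ε in 𝓝[>] (0:ℝ), c < 1 / ((h + 1).factorial : ℝ) * (1 / (1 + ε) ^ 2) ^ h :=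
      e1.filter_mono nhdsWithin_le_nhds
    obtain ⟨ε, a, b⟩ := (e2.and self_mem_nhdsWithin).exists
    exact ⟨ε, b, a⟩
  have hlarge : ∀ᶠ n : ℕ in atTop, h * (1 + ε) / ε ≤ (n : ℝ) :=
    tendsto_natCast_atTop_atTop.eventually_ge_atTop _
  filter_upwards [primepow_gap hε, hlarge, eventually_gt_atTop h] with n hn hn1 hn2
  obtain ⟨q, hq, hnq, hqn⟩ := hn
  refine hcε.le.trans (le_trans ?_ (ratio_ge hq hnq))
  have hq0 : (0:ℝ) < q := by exact_mod_cast hq.pos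
  have hn0 : (0:ℝ) < n := by exact_mod_cast (by omega : 0 < n)
  have key : 1 / (1 + ε) ^ 2 ≤ ((n + 1 - h : ℕ) : ℝ) / q := by
    rw [div_le_div_iff₀ (by positivity) hq0, Nat.cast_sub (by omega)]
    push_cast
    rw [div_le_iff₀ hε] at hn1
    have : (n : ℝ) ≤ (n + 1 - h) * (1 + ε) := by nlinarith
    calc 1 * (q : ℝ) ≤ (1 + ε) * n := by linarith
      _ ≤ (1 + ε) * ((n + 1 - h) * (1 + ε)) := by gcongr
      _ = _ := by ring
  gcongr
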